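/- Assume case (BS1). There exist maps φ : [0, d)^ℕ → [0, d)^ℕ and r : [0, d)^ℕ → (ℤ_{≥1})^ℕ such that for all i ∈ [0, d)^ℕ and all k ∈ ℕ, b^d α_k(φ(i)) = α_k(i) b^{c·r(i)_k} holds in Γ. The maps φ and r are uniquely determined by these equations, φ(i)_k and r(i)_k depend only on i_0, …, i_k, and φ is a homeomorphism of [0, d)^ℕ equipped with the product topology (where [0, d) is discrete). -/

import Mathlib

inductive BSGen : Type
  | a : BSGen
  | b : BSGen

/-- The relations for the Baumslag–Solitar presentation `⟨a, b | a bᶜ = bᵉ a⟩`.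
For cases (BS1), (BS2) take `e = d`; for case (BS3) take `e = -d`. -/
def BSRel (c e : ℤ) : Set (FreeGroup BSGen) :=
  {FreeGroup.of BSGen.a * FreeGroup.of BSGen.b ^ c *
    (FreeGroup.of BSGen.b ^ e * FreeGroup.of BSGen.a)⁻¹}

/-- The Baumslag–Solitar group `Γ = ⟨a, b | a bᶜ = bᵉ a⟩`. -/
abbrev BSGroup (c e : ℤ) := PresentedGroup (BSRel c e)

/-- The generator `a` of `Γ`. -/
def bsa (c e : ℤ) : BSGroup c e := PresentedGroup.of BSGen.a

/-- The generator `b` of `Γ`. -/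
def bsb (c e : ℤ) : BSGroup c e := PresentedGroup.of BSGen.b

/-- `Λ`, the submonoid of `Γ` generated by `a` and `b`. -/
def bsΛ (c e : ℤ) : Submonoid (BSGroup c e) :=
  Submonoid.closure {bsa c e, bsb c e}

/-- `[0, d)^ℕ`, the space of sequences with entries in `[0, d)`, carrying the product
topology (each factor `[0, d) ⊆ ℤ` being discrete). -/
abbrev BSSeq (d : ℤ) := ℕ → (Set.Ico (0 : ℤ) d)

/-- For `i ∈ [0,d)^ℕ` and `k ∈ ℕ`, the element `α_k(i) = b^{i₀} a b^{i₁} a ⋯ b^{i_k} a`. -/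
def alphaSeq (c e d : ℤ) (i : BSSeq d) (k : ℕ) : BSGroup c e :=
  (List.ofFn (fun μ : Fin (k + 1) => bsb c e ^ ((i μ.1 : ℤ)) * bsa c e)).prod

theorem bsa_mul_bsb_zpow (c e : ℤ) : bsa c e * bsb c e ^ c = bsb c e ^ e * bsa c e := by
  have h : PresentedGroup.mk (BSRel c e) (FreeGroup.of BSGen.a * FreeGroup.of BSGen.b ^ c *
      (FreeGroup.of BSGen.b ^ e * FreeGroup.of BSGen.a)⁻¹) = 1 :=
    PresentedGroup.one_of_mem rfl
  rw [map_mul, map_inv, mul_inv_eq_one, map_mul, map_mul, map_zpow, map_zpow] at h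
  exact h

theorem bsa_mul_bsb_zpow_mul (c e n : ℤ) :
    bsa c e * bsb c e ^ (c * n) = bsb c e ^ (e * n) * bsa c e := by
  have h : SemiconjBy (bsa c e) (bsb c e ^ c) (bsb c e ^ e) := bsa_mul_bsb_zpow c e
  simpa only [zpow_mul] using (h.zpow_right n).eq

/-- The affine action of `Γ` on `ℚ`: `a` is multiplication by `e / c`, `b` is translation by `1`. -/
def bsAffineGen (c e : ℤ) (hc : c ≠ 0) (he : e ≠ 0) : BSGen → Equiv.Perm ℚ
  | .a => Equiv.mulRight₀ ((e : ℚ) / c) (div_ne_zero (Int.cast_ne_zero.2 he) (Int.cast_ne_zero.2 hc))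
  | .b => Equiv.addRight 1

theorem bsAffineGen_rel (c e : ℤ) (hc : c ≠ 0) (he : e ≠ 0) :
    ∀ x ∈ BSRel c e, FreeGroup.lift (bsAffineGen c e hc he) x = 1 := by
  rintro x rfl
  have hc' : (c : ℚ) ≠ 0 := Int.cast_ne_zero.2 hc
  rw [map_mul, map_inv, mul_inv_eq_one, map_mul, map_mul, map_zpow, map_zpow]
  ext q
  simp only [FreeGroup.lift_apply_of, bsAffineGen, Equiv.zsmul_addRight, Equiv.Perm.mul_apply,
    Equiv.coe_addRight, Equiv.mulRight₀_apply, zsmul_eq_mul, mul_one]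
  field_simp

theorem bsb_zpow_injective {c e : ℤ} (hc : c ≠ 0) (he : e ≠ 0) :
    Function.Injective fun n : ℤ => bsb c e ^ n := by
  intro m n h
  have h' := congrArg (fun g => PresentedGroup.toGroup (bsAffineGen_rel c e hc he) g 0) h
  simpa [bsb, bsAffineGen, Equiv.zsmul_addRight, PresentedGroup.toGroup.of] using h'

theorem alphaSeq_zero (c e d : ℤ) (i : BSSeq d) :
    alphaSeq c e d i 0 = bsb c e ^ (i 0 : ℤ) * bsa c e := by
  simp [alphaSeq]

theorem alphaSeq_succ (c e d : ℤ) (i : BSSeq d) (k : ℕ) :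
    alphaSeq c e d i (k + 1) =
      alphaSeq c e d i k * (bsb c e ^ (i (k + 1) : ℤ) * bsa c e) := by
  rw [alphaSeq, List.ofFn_succ_last, List.prod_append, List.prod_singleton]
  rfl

/-- The exponent of `b` that has to be moved past the `k`-th syllable, when the exponent `c * r k`
comes out of the `k`-th one. -/
def bsCarry (c d : ℤ) (r : ℕ → ℤ) : ℕ → ℤ
  | 0 => d
  | k + 1 => c * r k

theorem bsCarry_congr (c d : ℤ) {r r' : ℕ → ℤ} {k : ℕ} (h : ∀ μ < k, r μ = r' μ) :
    bsCarry c d r k = bsCarry c d r' k := by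
  cases k with
  | zero => rfl
  | succ k => simp [bsCarry, h k k.lt_succ_self]

/-- The arithmetic form of the equations `b^d α_k(j) = α_k(i) b^{c r_k}`. -/
def BSCarryEq (c d : ℤ) (i j : BSSeq d) (r : ℕ → ℤ) : Prop :=
  ∀ k, bsCarry c d r k + (j k : ℤ) = (i k : ℤ) + d * r k

theorem bsb_zpow_mul_syllable_iff {c d : ℤ} (hc : c ≠ 0) (hd : d ≠ 0) (s m n t : ℤ) :
    bsb c d ^ s * (bsb c d ^ m * bsa c d) = bsb c d ^ n * bsa c d * bsb c d ^ (c * t) ↔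
      s + m = n + d * t := by
  rw [mul_assoc, bsa_mul_bsb_zpow_mul, ← mul_assoc, ← mul_assoc, ← zpow_add, ← zpow_add,
    mul_left_inj]
  exact (bsb_zpow_injective hc hd).eq_iff

theorem forall_alphaSeq_eq_iff {c d : ℤ} (hc : c ≠ 0) (hd : d ≠ 0) (i j : BSSeq d) (r : ℕ → ℤ) :
    (∀ k, bsb c d ^ d * alphaSeq c d d j k = alphaSeq c d d i k * bsb c d ^ (c * r k)) ↔
      BSCarryEq c d i j r := by
  have zero_iff : bsb c d ^ d * alphaSeq c d d j 0 = alphaSeq c d d i 0 * bsb c d ^ (c * r 0) ↔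
      bsCarry c d r 0 + (j 0 : ℤ) = (i 0 : ℤ) + d * r 0 := by
    rw [alphaSeq_zero, alphaSeq_zero, bsb_zpow_mul_syllable_iff hc hd]
    rfl
  have succ_iff (k : ℕ)
      (h : bsb c d ^ d * alphaSeq c d d j k = alphaSeq c d d i k * bsb c d ^ (c * r k)) :
      bsb c d ^ d * alphaSeq c d d j (k + 1) =
          alphaSeq c d d i (k + 1) * bsb c d ^ (c * r (k + 1)) ↔
        bsCarry c d r (k + 1) + (j (k + 1) : ℤ) = (i (k + 1) : ℤ) + d * r (k + 1) := by
    rw [alphaSeq_succ, alphaSeq_succ, ← mul_assoc, h, mul_assoc, mul_assoc (alphaSeq c d d i k),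
      mul_right_inj, bsb_zpow_mul_syllable_iff hc hd]
    rfl
  constructor
  · intro h k
    cases k with
    | zero => exact zero_iff.1 (h 0)
    | succ k => exact (succ_iff k (h k)).1 (h (k + 1))
  · intro h k
    induction k with
    | zero => exact zero_iff.2 (h 0)
    | succ k ih => exact (succ_iff k ih).2 (h (k + 1))

/-- Euclidean division: a multiple of `d` is determined up to an error in `[0, d)`. -/
theorem eq_of_add_mul_eq {d : ℤ} (x y : Set.Ico (0 : ℤ) d) {m n : ℤ}
    (h : (x : ℤ) + d * m = y + d * n) : x = y ∧ m = n := by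
  obtain ⟨x, hx0, hxd⟩ := x
  obtain ⟨y, hy0, hyd⟩ := y
  have hmn : m = n := by
    simp only at h
    rcases lt_trichotomy m n with h' | h' | h'
    · nlinarith
    · exact h'
    · nlinarith
  subst hmn
  exact ⟨Subtype.ext (add_right_cancel h), rfl⟩

theorem BSCarryEq.eq_of_left {c d : ℤ} {i i' j j' : BSSeq d} {r r' : ℕ → ℤ}
    (h : BSCarryEq c d i j r) (h' : BSCarryEq c d i' j' r') (k : ℕ)
    (hi : ∀ μ ≤ k, i μ = i' μ) : j k = j' k ∧ r k = r' k := by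
  induction k using Nat.strong_induction_on with
  | _ k ih =>
    have hs := bsCarry_congr c d fun μ hμ => (ih μ hμ fun ν hν => hi ν (hν.trans hμ.le)).2
    have e := h k
    have e' := h' k
    rw [hs, hi k le_rfl] at e
    have := eq_of_add_mul_eq (j k) (j' k) (m := -r k) (n := -r' k) (by linarith)
    exact ⟨this.1, neg_injective this.2⟩

theorem BSCarryEq.eq_of_right {c d : ℤ} {i i' j j' : BSSeq d} {r r' : ℕ → ℤ}
    (h : BSCarryEq c d i j r) (h' : BSCarryEq c d i' j' r') (k : ℕ)
    (hj : ∀ μ ≤ k, j μ = j' μ) : i k = i' k ∧ r k = r' k := by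
  induction k using Nat.strong_induction_on with
  | _ k ih =>
    have hs := bsCarry_congr c d fun μ hμ => (ih μ hμ fun ν hν => hj ν (hν.trans hμ.le)).2
    have e := h k
    have e' := h' k
    rw [hs, hj k le_rfl] at e
    exact eq_of_add_mul_eq (i k) (i' k) (by linarith)

theorem BSCarryEq.one_le {c d : ℤ} (hd : 1 ≤ d) (hcd : d ≤ c) {i j : BSSeq d} {r : ℕ → ℤ}
    (h : BSCarryEq c d i j r) (k : ℕ) : 1 ≤ r k := by
  have step (k : ℕ) (hs : d ≤ bsCarry c d r k) : 1 ≤ r k := by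
    have e := h k
    have hj := (j k).2.1
    have hi := (i k).2.2
    by_contra! hr
    nlinarith
  induction k with
  | zero => exact step 0 le_rfl
  | succ k ih => exact step (k + 1) (by simp only [bsCarry]; nlinarith)

/-- The sequence `r` solving `BSCarryEq` for a given `i`. -/
def bsQuotLeft (c d : ℤ) (i : BSSeq d) : ℕ → ℤ
  | 0 => -(((i 0 : ℤ) - d) / d)
  | k + 1 => -(((i (k + 1) : ℤ) - c * bsQuotLeft c d i k) / d)

/-- The sequence `r` solving `BSCarryEq` for a given `j`. -/
def bsQuotRight (c d : ℤ) (j : BSSeq d) : ℕ → ℤ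
  | 0 => (d + (j 0 : ℤ)) / d
  | k + 1 => (c * bsQuotRight c d j k + (j (k + 1) : ℤ)) / d

theorem bsQuotLeft_eq (c d : ℤ) (i : BSSeq d) (k : ℕ) :
    bsQuotLeft c d i k = -(((i k : ℤ) - bsCarry c d (bsQuotLeft c d i) k) / d) := by
  cases k <;> rfl

theorem bsQuotRight_eq (c d : ℤ) (j : BSSeq d) (k : ℕ) :
    bsQuotRight c d j k = (bsCarry c d (bsQuotRight c d j) k + (j k : ℤ)) / d := by
  cases k <;> rfl

/-- The residue of an integer, as an element of `[0, d)`. -/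
def bsResidue {d : ℤ} (hd : 1 ≤ d) (n : ℤ) : Set.Ico (0 : ℤ) d :=
  ⟨n % d, Int.emod_nonneg n (by omega), Int.emod_lt_of_pos n (by omega)⟩

/-- The map `φ`. -/
def bsShift (c : ℤ) {d : ℤ} (hd : 1 ≤ d) (i : BSSeq d) : BSSeq d := fun k =>
  bsResidue hd ((i k : ℤ) - bsCarry c d (bsQuotLeft c d i) k)

/-- The inverse of the map `φ`. -/
def bsUnshift (c : ℤ) {d : ℤ} (hd : 1 ≤ d) (j : BSSeq d) : BSSeq d := fun k =>
  bsResidue hd (bsCarry c d (bsQuotRight c d j) k + (j k : ℤ))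

theorem bsCarryEq_bsShift (c : ℤ) {d : ℤ} (hd : 1 ≤ d) (i : BSSeq d) :
    BSCarryEq c d i (bsShift c hd i) (bsQuotLeft c d i) := by
  intro k
  rw [bsQuotLeft_eq c d i k]
  simp only [bsShift, bsResidue]
  linarith [Int.emod_add_mul_ediv ((i k : ℤ) - bsCarry c d (bsQuotLeft c d i) k) d]

theorem bsCarryEq_bsUnshift (c : ℤ) {d : ℤ} (hd : 1 ≤ d) (j : BSSeq d) :
    BSCarryEq c d (bsUnshift c hd j) j (bsQuotRight c d j) := by
  intro k
  rw [bsQuotRight_eq c d j k]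
  simp only [bsUnshift, bsResidue]
  linarith [Int.emod_add_mul_ediv (bsCarry c d (bsQuotRight c d j) k + (j k : ℤ)) d]

theorem continuous_bsCarry {X : Type*} [TopologicalSpace X] (c d : ℤ) {r : X → ℕ → ℤ} {k : ℕ}
    (h : ∀ μ < k, Continuous fun x => r x μ) : Continuous fun x => bsCarry c d (r x) k := by
  cases k with
  | zero => exact continuous_const
  | succ k => exact continuous_const.mul (h k k.lt_succ_self)

theorem continuous_coe_apply {d : ℤ} (k : ℕ) : Continuous fun i : BSSeq d => (i k : ℤ) :=
  continuous_subtype_val.comp (continuous_apply k)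

theorem continuous_bsQuotLeft (c d : ℤ) (k : ℕ) :
    Continuous fun i : BSSeq d => bsQuotLeft c d i k := by
  induction k using Nat.strong_induction_on with
  | _ k ih =>
    simp only [bsQuotLeft_eq c d _ k]
    exact (continuous_of_discreteTopology (f := fun n : ℤ => -(n / d))).comp
      ((continuous_coe_apply k).sub (continuous_bsCarry c d ih))

theorem continuous_bsQuotRight (c d : ℤ) (k : ℕ) :
    Continuous fun j : BSSeq d => bsQuotRight c d j k := by
  induction k using Nat.strong_induction_on with
  | _ k ih =>
    simp only [bsQuotRight_eq c d _ k]
    exact (continuous_of_discreteTopology (f := fun n : ℤ => n / d)).comp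
      ((continuous_bsCarry c d ih).add (continuous_coe_apply k))

/-- The map `φ` as a homeomorphism. -/
def bsShiftHomeomorph (c : ℤ) {d : ℤ} (hd : 1 ≤ d) : BSSeq d ≃ₜ BSSeq d where
  toFun := bsShift c hd
  invFun := bsUnshift c hd
  left_inv i := funext fun k => ((bsCarryEq_bsUnshift c hd (bsShift c hd i)).eq_of_right
    (bsCarryEq_bsShift c hd i) k fun _ _ => rfl).1
  right_inv j := funext fun k => ((bsCarryEq_bsShift c hd (bsUnshift c hd j)).eq_of_left
    (bsCarryEq_bsUnshift c hd j) k fun _ _ => rfl).1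
  continuous_toFun := continuous_pi fun k =>
    (continuous_of_discreteTopology (f := bsResidue hd)).comp
      ((continuous_coe_apply k).sub (continuous_bsCarry c d fun μ _ => continuous_bsQuotLeft c d μ))
  continuous_invFun := continuous_pi fun k =>
    (continuous_of_discreteTopology (f := bsResidue hd)).comp
      ((continuous_bsCarry c d fun μ _ => continuous_bsQuotRight c d μ).add (continuous_coe_apply k))

/-- Case (BS1).  There exist maps `φ : [0,d)^ℕ → [0,d)^ℕ` and `r : [0,d)^ℕ → (ℤ≥1)^ℕ`
with `b^d α_k(φ(i)) = α_k(i) b^{c·r(i)_k}` for all `i, k`; `φ` and `r` are uniquely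
determined by these equations; `φ(i)_k` and `r(i)_k` depend only on `i₀, …, i_k`; and
`φ` is a homeomorphism of `[0,d)^ℕ` with the product topology. -/
theorem statement7 (c d : ℤ) (hd : 1 ≤ d) (hcd : d ≤ c) :
    ∃ (φ : BSSeq d ≃ₜ BSSeq d) (r : BSSeq d → ℕ → ℤ),
      (∀ i k, 1 ≤ r i k) ∧
      (∀ i k, bsb c d ^ d * alphaSeq c d d (φ i) k =
        alphaSeq c d d i k * bsb c d ^ (c * r i k)) ∧
      (∀ (φ' : BSSeq d → BSSeq d) (r' : BSSeq d → ℕ → ℤ),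
        (∀ i k, bsb c d ^ d * alphaSeq c d d (φ' i) k =
          alphaSeq c d d i k * bsb c d ^ (c * r' i k)) →
        (∀ i, φ' i = φ i) ∧ r' = r) ∧
      (∀ i j : BSSeq d, ∀ k : ℕ, (∀ μ ≤ k, i μ = j μ) →
        (φ i) k = (φ j) k ∧ r i k = r j k) := by
  have hc0 : c ≠ 0 := by omega
  have hd0 : d ≠ 0 := by omega
  have key := bsCarryEq_bsShift c hd
  refine ⟨bsShiftHomeomorph c hd, bsQuotLeft c d, fun i k => (key i).one_le hd hcd k,
    fun i => (forall_alphaSeq_eq_iff hc0 hd0 i _ _).2 (key i), fun φ' r' h => ?_,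
    fun i j k hij => (key i).eq_of_left (key j) k hij⟩
  have h' (i : BSSeq d) (k : ℕ) : φ' i k = bsShift c hd i k ∧ r' i k = bsQuotLeft c d i k :=
    ((forall_alphaSeq_eq_iff hc0 hd0 i _ _).1 (h i)).eq_of_left (key i) k fun _ _ => rfl
  exact ⟨fun i => funext fun k => (h' i k).1, funext fun i => funext fun k => (h' i k).2⟩
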